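/- arXiv:2408.02613 — 2 statements merged into one kernel-verified Lean document; each statement's English description precedes it below -/
import Mathlib

section
/- Let p > 0 and let β > −1 be such that the function x ↦ 𝒟_β^[p](1 : x) is integrable on ℝ². Then for every s > 0 and every x ∈ (−1/2, 1/2]², the series Σ_{n ∈ ℤ² \ {0}} J_{β+1}^[p](2π s^(1/p) (x − n)) / (2π s^(1/p) |x − n|_p)^(β+1) converges absolutely, i.e. Σ_{n ∈ ℤ² \ {0}} |J_{β+1}^[p](2π s^(1/p) (x − n))| / (2π s^(1/p) |x − n|_p)^(β+1) < ∞. -/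
open Real MeasureTheory

/-- The `p`-norm of a point of `ℝ²`. -/
noncomputable def pnorm (p : ℝ) (x : ℝ × ℝ) : ℝ := (|x.1| ^ p + |x.2| ^ p) ^ (1 / p)

/-- The generalized Bessel function of order zero `J₀^[p]`. -/
noncomputable def Jzero (p : ℝ) (η : ℝ × ℝ) : ℝ :=
  (1 / Real.Gamma (1 / p) ^ 2) * (2 / p) ^ 2 *
    ∫ t in (0:ℝ)..1,
      Real.cos (η.1 * t ^ (1 / p)) * Real.cos (η.2 * (1 - t) ^ (1 / p)) *
        t ^ (1 / p - 1) * (1 - t) ^ (1 / p - 1)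

/-- The generalized Bessel function of positive order `J_ω^[p]`. -/
noncomputable def Jord (p ω : ℝ) (η : ℝ × ℝ) : ℝ :=
  pnorm p η ^ ω / (p ^ (ω - 1) * Real.Gamma ω) *
    ∫ τ in (0:ℝ)..1, Jzero p (τ * η.1, τ * η.2) * τ * (1 - τ ^ p) ^ (ω - 1)

/-- `e^{2πiθ}`. -/
noncomputable def e2πi (θ : ℝ) : ℂ := Complex.exp (((2 * Real.pi * θ : ℝ) : ℂ) * Complex.I)

/-- The integral version `𝒟_β^[p](s : x)`. -/
noncomputable def Dcal (p β s : ℝ) (x : ℝ × ℝ) : ℂ :=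
  ((1 / Real.Gamma (β + 1) : ℝ) : ℂ) *
    ∫ ξ in {ξ : ℝ × ℝ | pnorm p ξ ^ p < s},
      (((s - pnorm p ξ ^ p) ^ β : ℝ) : ℂ) * e2πi (x.1 * ξ.1 + x.2 * ξ.2)

/-- The lattice sum version `D_β^[p](s : x)`. -/
noncomputable def Dlat (p β s : ℝ) (x : ℝ × ℝ) : ℂ :=
  ((1 / Real.Gamma (β + 1) : ℝ) : ℂ) *
    ∑' m : ℤ × ℤ,
      if pnorm p ((m.1 : ℝ), (m.2 : ℝ)) ^ p < s then
        (((s - pnorm p ((m.1 : ℝ), (m.2 : ℝ)) ^ p) ^ β : ℝ) : ℂ) *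
          e2πi (x.1 * (m.1 : ℝ) + x.2 * (m.2 : ℝ))
      else 0

lemma continuous_e2πi : Continuous e2πi := by unfold e2πi; fun_prop

lemma norm_e2πi (θ : ℝ) : ‖e2πi θ‖ = 1 := Complex.norm_exp_ofReal_mul_I _

lemma e2πi_add (a b : ℝ) : e2πi (a + b) = e2πi a * e2πi b := by
  simp only [e2πi, ← Complex.exp_add]
  congr 1
  push_cast
  ring

/-- A Schwartz function whose Fourier transform equals `1` on `[-1, 1]`. -/
lemma exists_schwartz_fourier_eq_one :
    ∃ φ : SchwartzMap ℝ ℂ, ∀ ξ ∈ Set.Icc (-1 : ℝ) 1, ∫ v, φ v * e2πi (-(v * ξ)) = 1 := by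
  let b : ContDiffBump (0 : ℝ) := ⟨1, 2, one_pos, one_lt_two⟩
  have hs : HasCompactSupport (fun x => ((b x : ℝ) : ℂ)) :=
    b.hasCompactSupport.comp_left (g := fun r : ℝ => (r : ℂ)) Complex.ofReal_zero
  have hd : ContDiff ℝ (⊤ : ℕ∞) (fun x => ((b x : ℝ) : ℂ)) :=
    Complex.ofRealCLM.contDiff.comp b.contDiff
  let χ : SchwartzMap ℝ ℂ := hs.toSchwartzMap hd
  refine ⟨FourierTransform.fourierInv χ, fun ξ hξ => ?_⟩
  have h1 : FourierTransform.fourier (FourierTransform.fourierInv χ) ξ = χ ξ := by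
    rw [FourierTransform.fourier_fourierInv_eq]
  have h2 : χ ξ = 1 := by
    change ((b ξ : ℝ) : ℂ) = 1
    rw [b.one_of_mem_closedBall]
    · simp
    · simpa [abs_le] using hξ
  rw [h2, SchwartzMap.fourier_coe, Real.fourier_eq'] at h1
  rw [← h1]
  refine integral_congr_ae (Filter.Eventually.of_forall fun v => ?_)
  simp only [e2πi, smul_eq_mul]
  rw [mul_comm]
  congr 2
  simp
  ring

lemma SchwartzMap.exists_norm_le_div (φ : SchwartzMap ℝ ℂ) :
    ∃ K : ℝ, 0 ≤ K ∧ ∀ v, ‖φ v‖ ≤ K / (1 + v ^ 2) := by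
  obtain ⟨C₀, hC₀, h₀⟩ := φ.decay 0 0
  obtain ⟨C₂, hC₂, h₂⟩ := φ.decay 2 0
  refine ⟨C₀ + C₂, by positivity, fun v => ?_⟩
  have h₀ := h₀ v
  have h₂ := h₂ v
  rw [norm_iteratedFDeriv_zero] at h₀ h₂
  rw [le_div_iff₀ (by positivity)]
  rw [Real.norm_eq_abs, sq_abs] at h₂
  linarith

lemma exists_int_one_div_le {c : ℝ} (hc : 0 < c) :
    ∃ K : ℝ, 0 ≤ K ∧ ∀ a : ℝ, ∃ m : ℤ, ∀ n : ℤ,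
      1 / (1 + (a - c * n) ^ 2) ≤ K * (1 / (1 + ((n + m : ℤ) : ℝ) ^ 2)) := by
  refine ⟨3 + 2 / c ^ 2, by positivity, fun a => ⟨-⌊a / c⌋, fun n => ?_⟩⟩
  have hθ₀ := Int.fract_nonneg (a / c)
  have hθ₁ := (Int.fract_lt_one (a / c)).le
  have ha : a = c * (⌊a / c⌋ + Int.fract (a / c)) := by
    rw [Int.floor_add_fract]; field_simp
  set θ := Int.fract (a / c)
  set k : ℝ := ((n + -⌊a / c⌋ : ℤ) : ℝ) with hk
  have h : a - c * n = c * (θ - k) := by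
    rw [hk]; push_cast; linear_combination ha
  rw [h, mul_one_div, div_le_div_iff₀ (by positivity) (by positivity)]
  have h2 : 1 + k ^ 2 ≤ 3 + 2 * (θ - k) ^ 2 := by nlinarith [sq_nonneg (2 * θ - k)]
  have h3 : (3 + 2 / c ^ 2) * (1 + (c * (θ - k)) ^ 2) =
      3 + 2 * (θ - k) ^ 2 + (3 * c ^ 2 * (θ - k) ^ 2 + 2 / c ^ 2) := by
    field_simp; ring
  rw [h3, one_mul]
  have : 0 ≤ 3 * c ^ 2 * (θ - k) ^ 2 + 2 / c ^ 2 := by positivity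
  linarith

lemma summable_one_div_one_add_sq_int :
    Summable fun n : ℤ => 1 / (1 + (n : ℝ) ^ 2) := by
  refine Summable.of_nonneg_of_le (fun n => by positivity) (fun n => ?_)
    (((Real.summable_one_div_int_pow (p := 2)).mpr one_lt_two).add
      (summable_of_hasFiniteSupport (f := fun n : ℤ => if n = 0 then (1 : ℝ) else 0) ?_))
  · by_cases h : n = 0
    · simp [h]
    · have : (0 : ℝ) < (n : ℝ) ^ 2 := by positivity
      simp only [h, if_false, add_zero]
      gcongr
      linarith
  · exact (Set.finite_singleton (0 : ℤ)).subset fun n hn => by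
      by_contra h
      simp_all

/-- The translates of a rapidly decaying kernel along a lattice have uniformly bounded sums. -/
lemma SchwartzMap.exists_sum_lattice_le (φ : SchwartzMap ℝ ℂ) {c : ℝ} (hc : 0 < c) :
    ∃ C : ℝ, ∀ (a : ℝ × ℝ) (S : Finset (ℤ × ℤ)),
      ∑ n ∈ S, ‖φ (a.1 - c * n.1) * φ (a.2 - c * n.2)‖ ≤ C := by
  obtain ⟨K, hK, hφ⟩ := φ.exists_norm_le_div
  obtain ⟨L, hL, hm⟩ := exists_int_one_div_le hc
  let g : ℤ → ℝ := fun n => 1 / (1 + (n : ℝ) ^ 2)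
  have hg : ∀ n, 0 ≤ g n := fun n => by positivity
  have hsum : Summable fun n : ℤ × ℤ => g n.1 * g n.2 :=
    summable_one_div_one_add_sq_int.mul_of_nonneg summable_one_div_one_add_sq_int hg hg
  refine ⟨(K * L) ^ 2 * ∑' n : ℤ × ℤ, g n.1 * g n.2, fun a S => ?_⟩
  obtain ⟨m₁, h₁⟩ := hm a.1
  obtain ⟨m₂, h₂⟩ := hm a.2
  have bound : ∀ (b : ℝ) (m : ℤ),
      (∀ n : ℤ, 1 / (1 + (b - c * n) ^ 2) ≤ L * (1 / (1 + ((n + m : ℤ) : ℝ) ^ 2))) →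
      ∀ n : ℤ, ‖φ (b - c * n)‖ ≤ K * L * g (n + m) := fun b m h n =>
    calc ‖φ (b - c * n)‖ ≤ K * (1 / (1 + (b - c * n) ^ 2)) := by
          rw [mul_one_div]; exact hφ _
      _ ≤ K * (L * g (n + m)) := mul_le_mul_of_nonneg_left (h n) hK
      _ = K * L * g (n + m) := by ring
  let e : ℤ × ℤ ≃ ℤ × ℤ := (Equiv.addRight m₁).prodCongr (Equiv.addRight m₂)
  calc ∑ n ∈ S, ‖φ (a.1 - c * n.1) * φ (a.2 - c * n.2)‖
      ≤ ∑ n ∈ S, (K * L) ^ 2 * (g (e n).1 * g (e n).2) := by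
        refine Finset.sum_le_sum fun n _ => ?_
        rw [norm_mul]
        calc _ ≤ (K * L * g (n.1 + m₁)) * (K * L * g (n.2 + m₂)) :=
              mul_le_mul (bound _ _ h₁ _) (bound _ _ h₂ _) (norm_nonneg _)
                (mul_nonneg (by positivity) (hg _))
          _ = (K * L) ^ 2 * (g (n.1 + m₁) * g (n.2 + m₂)) := by ring
          _ = _ := rfl
    _ = (K * L) ^ 2 * ∑ n ∈ S, g (e n).1 * g (e n).2 := by rw [Finset.mul_sum]
    _ ≤ (K * L) ^ 2 * ∑' n : ℤ × ℤ, g (e n).1 * g (e n).2 := by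
        refine mul_le_mul_of_nonneg_left ?_ (by positivity)
        exact ((e.summable_iff (f := fun n : ℤ × ℤ => g n.1 * g n.2)).mpr hsum).sum_le_tsum _
          (fun n _ => mul_nonneg (hg _) (hg _))
    _ = _ := by rw [e.tsum_eq (fun n : ℤ × ℤ => g n.1 * g n.2)]

/-- The Fourier integral of a function supported in `[-1, 1]²` is reproduced by convolution with a
band-limiting kernel. -/
lemma fourierIntegral_eq_convolution {f : ℝ × ℝ → ℂ} (hf : Integrable f)
    (hsupp : ∀ ξ, f ξ ≠ 0 → ξ.1 ∈ Set.Icc (-1 : ℝ) 1 ∧ ξ.2 ∈ Set.Icc (-1 : ℝ) 1)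
    {φ : SchwartzMap ℝ ℂ}
    (hφ : ∀ ξ ∈ Set.Icc (-1 : ℝ) 1, ∫ v, φ v * e2πi (-(v * ξ)) = 1) (y : ℝ × ℝ) :
    ∫ ξ, f ξ * e2πi (y.1 * ξ.1 + y.2 * ξ.2) =
      ∫ u : ℝ × ℝ, (∫ ξ, f ξ * e2πi (u.1 * ξ.1 + u.2 * ξ.2)) *
        (φ (y.1 - u.1) * φ (y.2 - u.2)) := by
  have hψ : Integrable fun v : ℝ × ℝ => φ v.1 * φ v.2 := φ.integrable.mul_prod φ.integrable
  conv_rhs => rw [← integral_sub_left_eq_self _ volume y]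
  have h1 : Integrable (fun z : (ℝ × ℝ) × (ℝ × ℝ) =>
      (φ z.1.1 * φ z.1.2) * f z.2 *
        e2πi ((y.1 - z.1.1) * z.2.1 + (y.2 - z.1.2) * z.2.2)) (volume.prod volume) := by
    refine (hψ.mul_prod hf).mul_bdd (c := 1) ?_
      (Filter.Eventually.of_forall fun z => (norm_e2πi _).le)
    exact (continuous_e2πi.comp (by fun_prop)).aestronglyMeasurable
  calc ∫ ξ, f ξ * e2πi (y.1 * ξ.1 + y.2 * ξ.2)
      = ∫ ξ, ∫ v : ℝ × ℝ, (φ v.1 * φ v.2) * f ξ *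
          e2πi ((y.1 - v.1) * ξ.1 + (y.2 - v.2) * ξ.2) := by
        refine integral_congr_ae (Filter.Eventually.of_forall fun ξ => ?_)
        have h2 : ∀ v : ℝ × ℝ, (φ v.1 * φ v.2) * f ξ *
            e2πi ((y.1 - v.1) * ξ.1 + (y.2 - v.2) * ξ.2) =
            f ξ * e2πi (y.1 * ξ.1 + y.2 * ξ.2) *
              ((φ v.1 * e2πi (-(v.1 * ξ.1))) * (φ v.2 * e2πi (-(v.2 * ξ.2)))) := fun v => by
          have : (y.1 - v.1) * ξ.1 + (y.2 - v.2) * ξ.2 =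
            (y.1 * ξ.1 + y.2 * ξ.2) + (-(v.1 * ξ.1) + -(v.2 * ξ.2)) := by ring
          rw [this, e2πi_add, e2πi_add (-(v.1 * ξ.1))]
          ring
        simp only [h2]
        rw [integral_const_mul, Measure.volume_eq_prod,
          integral_prod_mul (fun v => φ v * e2πi (-(v * ξ.1))) (fun v => φ v * e2πi (-(v * ξ.2)))]
        by_cases h0 : f ξ = 0
        · simp [h0]
        · rw [hφ _ (hsupp ξ h0).1, hφ _ (hsupp ξ h0).2]
          ring
    _ = ∫ v : ℝ × ℝ, ∫ ξ, (φ v.1 * φ v.2) * f ξ *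
          e2πi ((y.1 - v.1) * ξ.1 + (y.2 - v.2) * ξ.2) := (integral_integral_swap h1).symm
    _ = _ := by
        refine integral_congr_ae (Filter.Eventually.of_forall fun v => ?_)
        simp only [Prod.fst_sub, Prod.snd_sub, sub_sub_cancel]
        simp only [mul_assoc (φ v.1 * φ v.2), integral_const_mul]
        exact mul_comm _ _

/-- A Plancherel–Pólya type statement: an integrable Fourier integral of a function supported in
`[-1, 1]²` is absolutely summable over any translate of a lattice. -/
lemma summable_norm_fourierIntegral {f : ℝ × ℝ → ℂ} (hf : Integrable f)
    (hsupp : ∀ ξ, f ξ ≠ 0 → ξ.1 ∈ Set.Icc (-1 : ℝ) 1 ∧ ξ.2 ∈ Set.Icc (-1 : ℝ) 1)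
    (hF : Integrable fun y : ℝ × ℝ => ∫ ξ, f ξ * e2πi (y.1 * ξ.1 + y.2 * ξ.2))
    {c : ℝ} (hc : 0 < c) (x : ℝ × ℝ) :
    Summable fun n : ℤ × ℤ =>
      ‖∫ ξ, f ξ * e2πi (c * (x.1 - n.1) * ξ.1 + c * (x.2 - n.2) * ξ.2)‖ := by
  obtain ⟨φ, hφ⟩ := exists_schwartz_fourier_eq_one
  obtain ⟨C, hC⟩ := φ.exists_sum_lattice_le hc
  obtain ⟨K, -, hK⟩ := φ.exists_norm_le_div
  have hφK : ∀ v, ‖φ v‖ ≤ K := fun v => by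
    refine (hK v).trans (div_le_self ?_ (by nlinarith [sq_nonneg v]))
    simpa using (norm_nonneg _).trans (hK 0)
  set F : ℝ × ℝ → ℂ := fun y => ∫ ξ, f ξ * e2πi (y.1 * ξ.1 + y.2 * ξ.2) 
  let ψ : ℤ × ℤ → ℝ × ℝ → ℂ := fun n u =>
    φ (c * (x.1 - n.1) - u.1) * φ (c * (x.2 - n.2) - u.2)
  have hFψ : ∀ n, Integrable fun u => F u * ψ n u := fun n => by
    refine hF.mul_bdd (c := K * K) ?_ (Filter.Eventually.of_forall fun u => ?_)
    · have := φ.continuous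
      exact Continuous.aestronglyMeasurable (by fun_prop)
    · rw [norm_mul]
      exact mul_le_mul (hφK _) (hφK _) (norm_nonneg _) ((norm_nonneg _).trans (hφK 0))
  refine summable_of_sum_le (c := ∫ u, ‖F u‖ * C) (fun _ => norm_nonneg _) fun S => ?_
  calc ∑ n ∈ S, ‖F (c * (x.1 - n.1), c * (x.2 - n.2))‖
      ≤ ∑ n ∈ S, ∫ u, ‖F u * ψ n u‖ := by
        refine Finset.sum_le_sum fun n _ => ?_
        exact (congrArg norm (fourierIntegral_eq_convolution hf hsupp hφ _)).trans_le
          (norm_integral_le_integral_norm _)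
    _ = ∫ u, ∑ n ∈ S, ‖F u * ψ n u‖ := (integral_finsetSum _ fun n _ => (hFψ n).norm).symm
    _ ≤ ∫ u, ‖F u‖ * C := by
        refine integral_mono (integrable_finsetSum _ fun n _ => (hFψ n).norm)
          (hF.norm.mul_const C) fun u => ?_
        simp only [norm_mul (F u), ← Finset.mul_sum]
        refine mul_le_mul_of_nonneg_left (le_of_eq_of_le ?_
          (hC (c * x.1 - u.1, c * x.2 - u.2) S)) (norm_nonneg _)
        refine Finset.sum_congr rfl fun n _ => ?_
        simp only [ψ]
        ring_nf

lemma integrableOn_rpow_mul_one_sub_rpow {q : ℝ} (hq : 0 < q) :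
    IntegrableOn (fun t : ℝ => t ^ (q - 1) * (1 - t) ^ (q - 1)) (Set.Ioo 0 1) := by
  have h := Complex.betaIntegral_convergent (u := q) (v := q) (by simpa) (by simpa)
  rw [intervalIntegrable_iff_integrableOn_Ioo_of_le zero_le_one] at h
  refine IntegrableOn.congr_fun h.norm (fun t ht => ?_) measurableSet_Ioo
  have h1 : (1 - (t : ℂ)) = ((1 - t : ℝ) : ℂ) := by push_cast; rfl
  have h2 : 0 < 1 - t := sub_pos.mpr ht.2
  simp only [h1, norm_mul]
  rw [Complex.norm_cpow_eq_rpow_re_of_pos ht.1, Complex.norm_cpow_eq_rpow_re_of_pos h2]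
  simp

lemma min_one_mul_one_sub_le {p τ : ℝ} (hp : 0 < p) (hτ : τ ∈ Set.Ioo (0 : ℝ) 1) :
    min 1 p * (1 - τ) ≤ 1 - τ ^ p := by
  rcases le_total 1 p with h | h
  · rw [min_eq_left h]
    have := Real.rpow_le_rpow_of_exponent_ge hτ.1 hτ.2.le h
    rw [Real.rpow_one] at this
    linarith
  · rw [min_eq_right h]
    have := rpow_one_add_le_one_add_mul_self (s := τ - 1) (by linarith [hτ.1]) hp.le h
    rw [add_sub_cancel] at this
    linarith

lemma integrableOn_mul_one_sub_rpow {p β : ℝ} (hp : 0 < p) (hβ : -1 < β) :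
    IntegrableOn (fun τ : ℝ => τ * (1 - τ ^ p) ^ β) (Set.Ioo 0 1) := by
  have h1 : IntegrableOn (fun τ : ℝ => (1 - τ) ^ β) (Set.Ioo 0 1) := by
    have h := (intervalIntegral.intervalIntegrable_rpow' (a := 0) (b := 1) hβ).comp_sub_left 1
    rw [sub_zero, sub_self] at h
    exact (intervalIntegrable_iff_integrableOn_Ioo_of_le zero_le_one).mp h.symm
  have hm : 0 < min 1 p := lt_min one_pos hp
  refine Integrable.mono' (g := fun τ => (min 1 p) ^ β * (1 - τ) ^ β + 1)
    ((h1.const_mul _).add (integrableOn_const (by simp)))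
    (Measurable.aestronglyMeasurable (by fun_prop))
    (ae_restrict_of_forall_mem measurableSet_Ioo fun τ hτ => ?_)
  have h2 := min_one_mul_one_sub_le hp hτ
  have h3 : 0 < 1 - τ := sub_pos.mpr hτ.2
  have h4 : 0 < 1 - τ ^ p := (mul_pos hm h3).trans_le h2
  have h5 : 0 < τ ^ p := Real.rpow_pos_of_pos hτ.1 p
  have h6 : 0 ≤ (min 1 p) ^ β * (1 - τ) ^ β := by positivity
  rw [Real.norm_of_nonneg (mul_nonneg hτ.1.le (by positivity))]
  refine (mul_le_of_le_one_left (by positivity) hτ.2.le).trans ?_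
  rcases le_total 0 β with h | h
  · have := Real.rpow_le_one h4.le (by linarith) h
    linarith
  · have := Real.rpow_le_rpow_of_nonpos (mul_pos hm h3) h2 h
    rw [Real.mul_rpow hm.le h3.le] at this
    linarith

lemma pnorm_rpow {p : ℝ} (hp : 0 < p) (ξ : ℝ × ℝ) :
    pnorm p ξ ^ p = |ξ.1| ^ p + |ξ.2| ^ p := by
  rw [pnorm, ← Real.rpow_mul (by positivity), one_div_mul_cancel hp.ne', Real.rpow_one]

/-- Polar-type coordinates on the first quadrant adapted to the `p`-norm. -/
noncomputable def pPolar (p : ℝ) (z : ℝ × ℝ) : ℝ × ℝ :=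
  (z.1 * z.2 ^ (1 / p), z.1 * (1 - z.2) ^ (1 / p))

/-- The derivative of `pPolar`. -/
noncomputable def fderivPPolar (p : ℝ) (z : ℝ × ℝ) : ℝ × ℝ →L[ℝ] ℝ × ℝ :=
  (Matrix.toLin (.finTwoProd ℝ) (.finTwoProd ℝ)
    !![z.2 ^ (1 / p), z.1 * (1 / p * z.2 ^ (1 / p - 1));
      (1 - z.2) ^ (1 / p), z.1 * -(1 / p * (1 - z.2) ^ (1 / p - 1))]).toContinuousLinearMap

lemma hasFDerivAt_pPolar {p : ℝ} {z : ℝ × ℝ} (hz : z.2 ∈ Set.Ioo (0 : ℝ) 1) :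
    HasFDerivAt (pPolar p) (fderivPPolar p z) z := by
  have h1 : HasDerivAt (fun t : ℝ => t ^ (1 / p)) (1 / p * z.2 ^ (1 / p - 1)) z.2 :=
    Real.hasDerivAt_rpow_const (Or.inl hz.1.ne')
  have h2 : HasDerivAt (fun t : ℝ => (1 - t) ^ (1 / p)) (-(1 / p * (1 - z.2) ^ (1 / p - 1)))
      z.2 := by
    have := ((hasDerivAt_id z.2).const_sub 1).rpow_const (p := 1 / p)
      (Or.inl (sub_pos.mpr hz.2).ne')
    simpa using this
  unfold fderivPPolar
  rw [Matrix.toLin_finTwoProd_toContinuousLinearMap]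
  convert!
    HasFDerivAt.prodMk (𝕜 := ℝ)
      (hasFDerivAt_fst.mul (h1.comp_hasFDerivAt z hasFDerivAt_snd))
      (hasFDerivAt_fst.mul (h2.comp_hasFDerivAt z hasFDerivAt_snd)) using
    2 <;>
  simp [smul_smul, add_comm, smul_neg, neg_smul _ (ContinuousLinearMap.snd ℝ ℝ ℝ)]

lemma abs_det_fderivPPolar {p : ℝ} (hp : 0 < p) {z : ℝ × ℝ}
    (hz : z ∈ Set.Ioo (0 : ℝ) 1 ×ˢ Set.Ioo (0 : ℝ) 1) :
    |(fderivPPolar p z).det| =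
      1 / p * (z.1 * (z.2 ^ (1 / p - 1) * (1 - z.2) ^ (1 / p - 1))) := by
  obtain ⟨h1, h2, h3⟩ := hz
  have h4 : 0 < 1 - z.2 := sub_pos.mpr h3
  have h5 : (fderivPPolar p z).det =
      -(1 / p * (z.1 * (z.2 ^ (1 / p - 1) * (1 - z.2) ^ (1 / p - 1)))) := by
    unfold fderivPPolar
    rw [LinearMap.det_toContinuousLinearMap, LinearMap.det_toLin, Matrix.det_fin_two_of]
    rw [Real.rpow_sub_one h2.ne', Real.rpow_sub_one h4.ne']
    field_simp
    ring
  have := h1.1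
  rw [h5, abs_neg, abs_of_nonneg (by positivity)]

lemma mul_rpow_one_div_rpow {p a b : ℝ} (hp : 0 < p) (ha : 0 ≤ a) (hb : 0 ≤ b) :
    (a * b ^ (1 / p)) ^ p = a ^ p * b := by
  rw [Real.mul_rpow ha (by positivity), ← Real.rpow_mul hb, one_div_mul_cancel hp.ne',
    Real.rpow_one]

lemma pnorm_pPolar_rpow {p : ℝ} (hp : 0 < p) {z : ℝ × ℝ}
    (hz : z ∈ Set.Ioo (0 : ℝ) 1 ×ˢ Set.Ioo (0 : ℝ) 1) :
    pnorm p (pPolar p z) ^ p = z.1 ^ p := by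
  obtain ⟨h1, h2, h3⟩ := hz
  have h4 : 0 < 1 - z.2 := sub_pos.mpr h3
  have h5 := h1.1
  rw [pnorm_rpow hp, pPolar, abs_of_nonneg (by positivity), abs_of_nonneg (by positivity),
    mul_rpow_one_div_rpow hp h5.le h2.le, mul_rpow_one_div_rpow hp h5.le h4.le]
  ring

lemma injOn_pPolar {p : ℝ} (hp : 0 < p) :
    Set.InjOn (pPolar p) (Set.Ioo (0 : ℝ) 1 ×ˢ Set.Ioo (0 : ℝ) 1) := by
  intro z hz z' hz' h
  have h1 : z.1 = z'.1 := by
    have := pnorm_pPolar_rpow hp hz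
    rw [h, pnorm_pPolar_rpow hp hz'] at this
    exact (Real.rpow_left_injOn hp.ne' hz'.1.1.le hz.1.1.le this).symm
  have h2 : z.2 ^ (1 / p) = z'.2 ^ (1 / p) := by
    have := congrArg Prod.fst h
    simp only [pPolar, ← h1] at this
    exact mul_left_cancel₀ hz.1.1.ne' this
  exact Prod.ext h1 (Real.rpow_left_injOn (one_div_pos.mpr hp).ne' hz.2.1.le hz'.2.1.le h2)

lemma image_pPolar {p : ℝ} (hp : 0 < p) :
    pPolar p '' (Set.Ioo (0 : ℝ) 1 ×ˢ Set.Ioo (0 : ℝ) 1) =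
      (Set.Ioi 0 ×ˢ Set.Ioi 0) ∩ {ξ | pnorm p ξ ^ p < 1} := by
  ext ξ
  constructor
  · rintro ⟨z, hz, rfl⟩
    refine ⟨⟨?_, ?_⟩, ?_⟩
    · exact mul_pos hz.1.1 (Real.rpow_pos_of_pos hz.2.1 _)
    · exact mul_pos hz.1.1 (Real.rpow_pos_of_pos (sub_pos.mpr hz.2.2) _)
    · change pnorm p (pPolar p z) ^ p < 1
      rw [pnorm_pPolar_rpow hp hz]
      exact Real.rpow_lt_one hz.1.1.le hz.1.2 hp
  · rintro ⟨⟨h1, h2⟩, h3⟩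
    rw [Set.mem_Ioi] at h1 h2
    change pnorm p ξ ^ p < 1 at h3
    rw [pnorm_rpow hp, abs_of_pos h1, abs_of_pos h2] at h3
    have ha : 0 < ξ.1 ^ p := Real.rpow_pos_of_pos h1 p
    have hb : 0 < ξ.2 ^ p := Real.rpow_pos_of_pos h2 p
    set r := ξ.1 ^ p + ξ.2 ^ p with hr
    have hr0 : 0 < r := add_pos ha hb
    have key : ∀ a : ℝ, 0 < a → r ^ (1 / p) * (a ^ p / r) ^ (1 / p) = a := fun a ha => by
      rw [← Real.mul_rpow hr0.le (by positivity), mul_div_cancel₀ _ hr0.ne', ← Real.rpow_mul ha.le,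
        mul_one_div_cancel hp.ne', Real.rpow_one]
    refine ⟨(r ^ (1 / p), ξ.1 ^ p / r), ⟨⟨by positivity, ?_⟩, ⟨by positivity, ?_⟩⟩, ?_⟩
    · exact Real.rpow_lt_one hr0.le h3 (one_div_pos.mpr hp)
    · rw [div_lt_one hr0]
      linarith
    · have h4 : 1 - ξ.1 ^ p / r = ξ.2 ^ p / r := by
        field_simp
        rw [hr]; ring
      simp only [pPolar]
      rw [h4, key _ h1, key _ h2]

/-- The weight `(1 - |ξ|_p^p)^β` on the open unit ball of the `p`-norm, extended by zero. -/
noncomputable def ballWeight (p β : ℝ) : ℝ × ℝ → ℝ :=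
  {ξ | pnorm p ξ ^ p < 1}.indicator fun ξ => (1 - pnorm p ξ ^ p) ^ β

lemma measurable_pnorm (p : ℝ) : Measurable (pnorm p) := by
  unfold pnorm
  fun_prop

lemma measurableSet_pnorm_rpow_lt (p s : ℝ) : MeasurableSet {ξ | pnorm p ξ ^ p < s} :=
  measurableSet_lt ((measurable_pnorm p).pow_const p) measurable_const

lemma ballWeight_congr {p β : ℝ} {ξ ξ' : ℝ × ℝ} (h1 : |ξ.1| = |ξ'.1|) (h2 : |ξ.2| = |ξ'.2|) :
    ballWeight p β ξ = ballWeight p β ξ' := by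
  have : pnorm p ξ = pnorm p ξ' := by rw [pnorm, pnorm, h1, h2]
  simp [ballWeight, Set.indicator, this]

lemma mem_Icc_of_ballWeight_ne_zero {p β : ℝ} (hp : 0 < p) {ξ : ℝ × ℝ}
    (h : ballWeight p β ξ ≠ 0) : ξ.1 ∈ Set.Icc (-1 : ℝ) 1 ∧ ξ.2 ∈ Set.Icc (-1 : ℝ) 1 := by
  have h1 : pnorm p ξ ^ p < 1 := by
    by_contra hn
    exact h (Set.indicator_of_notMem (s := {ξ | pnorm p ξ ^ p < 1}) hn _)
  rw [pnorm_rpow hp] at h1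
  have ha : 0 ≤ |ξ.1| ^ p := by positivity
  have hb : 0 ≤ |ξ.2| ^ p := by positivity
  have key : ∀ a : ℝ, |a| ^ p < 1 → a ∈ Set.Icc (-1 : ℝ) 1 := fun a ha => by
    rw [Set.mem_Icc, ← abs_le]
    by_contra! hlt
    exact absurd ha (Real.one_le_rpow hlt.le hp.le).not_gt
  exact ⟨key _ (by linarith), key _ (by linarith)⟩

lemma abs_det_smul_ballWeight_pPolar {p β : ℝ} (hp : 0 < p) {z : ℝ × ℝ}
    (hz : z ∈ Set.Ioo (0 : ℝ) 1 ×ˢ Set.Ioo (0 : ℝ) 1) :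
    |(fderivPPolar p z).det| • ballWeight p β (pPolar p z) =
      1 / p * ((z.1 * (1 - z.1 ^ p) ^ β) * (z.2 ^ (1 / p - 1) * (1 - z.2) ^ (1 / p - 1))) := by
  have h : pPolar p z ∈ {ξ | pnorm p ξ ^ p < 1} := by
    have := Set.mem_image_of_mem (pPolar p) hz
    rw [image_pPolar hp] at this
    exact this.2
  rw [abs_det_fderivPPolar hp hz, ballWeight, Set.indicator_of_mem h, pnorm_pPolar_rpow hp hz,
    smul_eq_mul]
  ring

lemma setIntegral_quadrant_ballWeight_mul {p β : ℝ} (hp : 0 < p) (g : ℝ × ℝ → ℝ) :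
    ∫ ξ in Set.Ioi 0 ×ˢ Set.Ioi 0, ballWeight p β ξ * g ξ =
      ∫ z in Set.Ioo (0 : ℝ) 1 ×ˢ Set.Ioo (0 : ℝ) 1,
        1 / p * ((z.1 * (1 - z.1 ^ p) ^ β) * (z.2 ^ (1 / p - 1) * (1 - z.2) ^ (1 / p - 1))) *
          g (pPolar p z) := by
  have hS : MeasurableSet (Set.Ioo (0 : ℝ) 1 ×ˢ Set.Ioo (0 : ℝ) 1) :=
    measurableSet_Ioo.prod measurableSet_Ioo
  have h1 : ∫ ξ in Set.Ioi 0 ×ˢ Set.Ioi 0, ballWeight p β ξ * g ξ =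
      ∫ ξ in pPolar p '' (Set.Ioo (0 : ℝ) 1 ×ˢ Set.Ioo (0 : ℝ) 1), ballWeight p β ξ * g ξ := by
    rw [image_pPolar hp]
    refine (setIntegral_eq_of_subset_of_forall_sdiff_eq_zero
      (measurableSet_Ioi.prod measurableSet_Ioi) Set.inter_subset_left fun ξ hξ => ?_)
    rw [ballWeight, Set.indicator_of_notMem, zero_mul]
    exact fun h => hξ.2 ⟨hξ.1, h⟩
  rw [h1, integral_image_eq_integral_abs_det_fderiv_smul volume hS
    (fun z hz => (hasFDerivAt_pPolar hz.2).hasFDerivWithinAt) (injOn_pPolar hp)]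
  refine setIntegral_congr_fun hS fun z hz => ?_
  rw [← smul_mul_assoc, abs_det_smul_ballWeight_pPolar hp hz]

lemma integrableOn_quadrant_ballWeight {p β : ℝ} (hp : 0 < p) (hβ : -1 < β) :
    IntegrableOn (ballWeight p β) (Set.Ioi 0 ×ˢ Set.Ioi 0) := by
  have hS : MeasurableSet (Set.Ioo (0 : ℝ) 1 ×ˢ Set.Ioo (0 : ℝ) 1) :=
    measurableSet_Ioo.prod measurableSet_Ioo
  have h1 : IntegrableOn (ballWeight p β)
      (pPolar p '' (Set.Ioo (0 : ℝ) 1 ×ˢ Set.Ioo (0 : ℝ) 1)) := by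
    rw [integrableOn_image_iff_integrableOn_abs_det_fderiv_smul volume hS
      (fun z hz => (hasFDerivAt_pPolar hz.2).hasFDerivWithinAt) (injOn_pPolar hp)]
    refine IntegrableOn.congr_fun ?_ (fun z hz => (abs_det_smul_ballWeight_pPolar hp hz).symm) hS
    rw [IntegrableOn, Measure.volume_eq_prod, ← Measure.prod_restrict]
    exact ((integrableOn_mul_one_sub_rpow hp hβ).mul_prod
      (integrableOn_rpow_mul_one_sub_rpow (one_div_pos.mpr hp))).const_mul _
  rw [image_pPolar hp] at h1
  refine h1.of_forall_sdiff_eq_zero (measurableSet_Ioi.prod measurableSet_Ioi) fun ξ hξ => ?_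
  exact Set.indicator_of_notMem (fun h => hξ.2 ⟨hξ.1, h⟩) _

lemma measurePreserving_neg_fst :
    MeasurePreserving (fun ξ : ℝ × ℝ => (-ξ.1, ξ.2)) volume volume :=
  (Measure.measurePreserving_neg (volume : Measure ℝ)).prod (MeasurePreserving.id volume)

lemma measurePreserving_neg_snd :
    MeasurePreserving (fun ξ : ℝ × ℝ => (ξ.1, -ξ.2)) volume volume :=
  (MeasurePreserving.id volume).prod (Measure.measurePreserving_neg (volume : Measure ℝ))

lemma measurableEmbedding_neg_fst : MeasurableEmbedding (fun ξ : ℝ × ℝ => (-ξ.1, ξ.2)) :=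
  ((Homeomorph.neg ℝ).prodCongr (Homeomorph.refl ℝ)).measurableEmbedding

lemma measurableEmbedding_neg_snd : MeasurableEmbedding (fun ξ : ℝ × ℝ => (ξ.1, -ξ.2)) :=
  ((Homeomorph.refl ℝ).prodCongr (Homeomorph.neg ℝ)).measurableEmbedding

lemma integrable_ballWeight {p β : ℝ} (hp : 0 < p) (hβ : -1 < β) :
    Integrable (ballWeight p β) := by
  have h0 := integrableOn_quadrant_ballWeight hp hβ
  have h1 : IntegrableOn (ballWeight p β) (Set.Ioi 0 ×ˢ {0}ᶜ) := by
    have h := (measurePreserving_neg_snd.integrableOn_comp_preimage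
      measurableEmbedding_neg_snd).mpr h0
    have he : ballWeight p β ∘ (fun ξ : ℝ × ℝ => (ξ.1, -ξ.2)) = ballWeight p β :=
      funext fun ξ => ballWeight_congr rfl (abs_neg _)
    rw [he] at h
    refine (h0.union h).mono_set ?_
    rintro ⟨a, b⟩ ⟨ha, hb⟩
    rcases lt_or_gt_of_ne (show b ≠ 0 from hb) with hb | hb
    · exact Or.inr ⟨ha, neg_pos.mpr hb⟩
    · exact Or.inl ⟨ha, hb⟩
  have h2 : IntegrableOn (ballWeight p β) ({0}ᶜ ×ˢ {0}ᶜ) := by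
    have h := (measurePreserving_neg_fst.integrableOn_comp_preimage
      measurableEmbedding_neg_fst).mpr h1
    have he : ballWeight p β ∘ (fun ξ : ℝ × ℝ => (-ξ.1, ξ.2)) = ballWeight p β :=
      funext fun ξ => ballWeight_congr (abs_neg _) rfl
    rw [he] at h
    refine (h1.union h).mono_set ?_
    rintro ⟨a, b⟩ ⟨ha, hb⟩
    rcases lt_or_gt_of_ne (show a ≠ 0 from ha) with ha | ha
    · exact Or.inr ⟨neg_pos.mpr ha, hb⟩
    · exact Or.inl ⟨ha, hb⟩
  rw [IntegrableOn, Measure.volume_eq_prod, ← Measure.prod_restrict, restrict_compl_singleton,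
    ← Measure.volume_eq_prod] at h2
  exact h2

lemma e2πi_eq (θ : ℝ) :
    e2πi θ = (Real.cos (2 * π * θ) : ℂ) + (Real.sin (2 * π * θ) : ℂ) * Complex.I := by
  rw [e2πi, Complex.exp_mul_I, Complex.ofReal_cos, Complex.ofReal_sin]

lemma e2πi_add_e2πi_neg (θ : ℝ) : e2πi θ + e2πi (-θ) = 2 * (Real.cos (2 * π * θ) : ℂ) := by
  rw [e2πi_eq, e2πi_eq, mul_neg, Real.cos_neg, Real.sin_neg]
  push_cast
  ring

lemma integral_ballWeight_mul_e2πi {p β : ℝ} (hp : 0 < p) (hβ : -1 < β) (y : ℝ × ℝ) :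
    ∫ ξ, (ballWeight p β ξ : ℂ) * e2πi (y.1 * ξ.1 + y.2 * ξ.2) =
      ((∫ ξ, ballWeight p β ξ *
        (Real.cos (2 * π * (y.1 * ξ.1)) * Real.cos (2 * π * (y.2 * ξ.2))) : ℝ) : ℂ) := by
  have hw : Integrable fun ξ => (ballWeight p β ξ : ℂ) := (integrable_ballWeight hp hβ).ofReal
  have hcos : ∀ θ : ℝ, ‖(Real.cos θ : ℂ)‖ ≤ 1 := fun θ => by
    rw [Complex.norm_real]; exact Real.abs_cos_le_one θ
  have he := continuous_e2πi
  have i1 : ∀ a b : ℝ, Integrable fun ξ : ℝ × ℝ =>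
      (ballWeight p β ξ : ℂ) * (e2πi (a * ξ.1) * e2πi (b * ξ.2)) := fun a b => by
    refine hw.mul_bdd (c := 1) (Continuous.aestronglyMeasurable (by fun_prop))
      (Filter.Eventually.of_forall fun ξ => ?_)
    rw [norm_mul, norm_e2πi, norm_e2πi, one_mul]
  have i2 : ∀ a b : ℝ, Integrable fun ξ : ℝ × ℝ =>
      (ballWeight p β ξ : ℂ) * ((Real.cos (2 * π * (a * ξ.1)) : ℂ) * e2πi (b * ξ.2)) := fun a b => by
    refine hw.mul_bdd (c := 1) (Continuous.aestronglyMeasurable (by fun_prop))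
      (Filter.Eventually.of_forall fun ξ => ?_)
    rw [norm_mul, norm_e2πi, mul_one]
    exact hcos _
  have s1 : ∫ ξ, (ballWeight p β ξ : ℂ) * (e2πi (y.1 * ξ.1) * e2πi (y.2 * ξ.2)) =
      ∫ ξ, (ballWeight p β ξ : ℂ) * (e2πi (-y.1 * ξ.1) * e2πi (y.2 * ξ.2)) := by
    rw [← measurePreserving_neg_fst.integral_comp measurableEmbedding_neg_fst]
    congr with ξ
    rw [ballWeight_congr (ξ := (-ξ.1, ξ.2)) (ξ' := ξ) (abs_neg _) rfl, mul_neg, neg_mul]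
  have s2 : ∫ ξ, (ballWeight p β ξ : ℂ) *
        ((Real.cos (2 * π * (y.1 * ξ.1)) : ℂ) * e2πi (y.2 * ξ.2)) =
      ∫ ξ, (ballWeight p β ξ : ℂ) *
        ((Real.cos (2 * π * (y.1 * ξ.1)) : ℂ) * e2πi (-y.2 * ξ.2)) := by
    rw [← measurePreserving_neg_snd.integral_comp measurableEmbedding_neg_snd]
    congr with ξ
    rw [ballWeight_congr (ξ := (ξ.1, -ξ.2)) (ξ' := ξ) rfl (abs_neg _), mul_neg, neg_mul]
  have t1 : ∫ ξ, (ballWeight p β ξ : ℂ) * (e2πi (y.1 * ξ.1) * e2πi (y.2 * ξ.2)) =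
      ∫ ξ, (ballWeight p β ξ : ℂ) *
        ((Real.cos (2 * π * (y.1 * ξ.1)) : ℂ) * e2πi (y.2 * ξ.2)) := by
    refine mul_left_cancel₀ (two_ne_zero (α := ℂ)) ?_
    conv_lhs => rw [two_mul]
    conv_lhs => enter [2]; rw [s1]
    rw [← integral_add (i1 _ _) (i1 _ _), ← integral_const_mul]
    congr with ξ
    rw [neg_mul]
    linear_combination (ballWeight p β ξ : ℂ) * e2πi (y.2 * ξ.2) * e2πi_add_e2πi_neg (y.1 * ξ.1)
  have t2 : ∫ ξ, (ballWeight p β ξ : ℂ) *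
        ((Real.cos (2 * π * (y.1 * ξ.1)) : ℂ) * e2πi (y.2 * ξ.2)) =
      ∫ ξ, (ballWeight p β ξ : ℂ) *
        ((Real.cos (2 * π * (y.1 * ξ.1)) : ℂ) * (Real.cos (2 * π * (y.2 * ξ.2)) : ℂ)) := by
    refine mul_left_cancel₀ (two_ne_zero (α := ℂ)) ?_
    conv_lhs => rw [two_mul]
    conv_lhs => enter [2]; rw [s2]
    rw [← integral_add (i2 _ _) (i2 _ _), ← integral_const_mul]
    congr with ξ
    rw [neg_mul]
    linear_combination (ballWeight p β ξ : ℂ) * (Real.cos (2 * π * (y.1 * ξ.1)) : ℂ) *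
      e2πi_add_e2πi_neg (y.2 * ξ.2)
  simp only [e2πi_add]
  rw [t1, t2, ← integral_complex_ofReal]
  push_cast
  rfl

lemma integrable_ballWeight_mul_cos {p β : ℝ} (hp : 0 < p) (hβ : -1 < β) (y : ℝ × ℝ) :
    Integrable fun ξ : ℝ × ℝ => ballWeight p β ξ *
      (Real.cos (2 * π * (y.1 * ξ.1)) * Real.cos (2 * π * (y.2 * ξ.2))) := by
  refine (integrable_ballWeight hp hβ).mul_bdd (c := 1)
    (Continuous.aestronglyMeasurable (by fun_prop)) (Filter.Eventually.of_forall fun ξ => ?_)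
  rw [norm_mul]
  exact mul_le_one₀ (Real.abs_cos_le_one _) (norm_nonneg _) (Real.abs_cos_le_one _)

/-- An integrable function on the plane that is even in both variables integrates to four times
its integral over the first quadrant. -/
lemma integral_eq_four_mul_setIntegral_quadrant {g : ℝ × ℝ → ℝ} (hg : Integrable g)
    (heven : ∀ a b, g (|a|, |b|) = g (a, b)) :
    ∫ ξ, g ξ = 4 * ∫ ξ in Set.Ioi 0 ×ˢ Set.Ioi 0, g ξ := by
  have h1 : ∀ a, ∫ b, g (a, b) = 2 * ∫ b in Set.Ioi 0, g (|a|, b) := fun a => by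
    rw [← integral_comp_abs]
    simp only [heven]
  rw [Measure.volume_eq_prod, integral_prod _ hg, setIntegral_prod _ hg.integrableOn]
  simp only [h1]
  rw [integral_const_mul, integral_comp_abs (f := fun a => ∫ b in Set.Ioi 0, g (a, b))]
  ring

lemma integral_Jzero_mul {p β : ℝ} (hp : 0 < p) (hβ : -1 < β) (y : ℝ × ℝ) :
    ((∫ τ in (0 : ℝ)..1,
        Jzero p (τ * (2 * π * y.1), τ * (2 * π * y.2)) * τ * (1 - τ ^ p) ^ β : ℝ) : ℂ) =
      ((1 / Real.Gamma (1 / p) ^ 2 * (1 / p) : ℝ) : ℂ) *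
        ∫ ξ, (ballWeight p β ξ : ℂ) * e2πi (y.1 * ξ.1 + y.2 * ξ.2) := by
  have hi := integrable_ballWeight_mul_cos hp hβ y
  have hcos : ∀ c a : ℝ, Real.cos (2 * π * (c * |a|)) = Real.cos (2 * π * (c * a)) := fun c a => by
    rcases abs_choice a with h | h <;> simp [h]
  have heven : ∀ a b : ℝ, ballWeight p β (|a|, |b|) *
      (Real.cos (2 * π * (y.1 * |a|)) * Real.cos (2 * π * (y.2 * |b|))) =
      ballWeight p β (a, b) * (Real.cos (2 * π * (y.1 * a)) * Real.cos (2 * π * (y.2 * b))) :=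
    fun a b => by
      rw [hcos, hcos, ballWeight_congr (ξ := (|a|, |b|)) (ξ' := (a, b)) (abs_abs a) (abs_abs b)]
  rw [integral_ballWeight_mul_e2πi hp hβ, ← Complex.ofReal_mul, Complex.ofReal_inj,
    integral_eq_four_mul_setIntegral_quadrant hi heven, setIntegral_quadrant_ballWeight_mul hp,
    Measure.volume_eq_prod, setIntegral_prod,
    intervalIntegral.integral_of_le zero_le_one, integral_Ioc_eq_integral_Ioo,
    ← integral_const_mul, ← integral_const_mul]
  · refine setIntegral_congr_fun measurableSet_Ioo fun τ _ => ?_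
    simp only [Jzero, pPolar]
    rw [intervalIntegral.integral_of_le zero_le_one, integral_Ioc_eq_integral_Ioo,
      ← integral_const_mul, ← integral_const_mul, ← integral_const_mul, ← integral_mul_const,
      ← integral_mul_const]
    refine setIntegral_congr_fun measurableSet_Ioo fun t _ => ?_
    have e1 : τ * (2 * π * y.1) * t ^ (1 / p) = 2 * π * (y.1 * (τ * t ^ (1 / p))) := by ring
    have e2 : τ * (2 * π * y.2) * (1 - t) ^ (1 / p) =
      2 * π * (y.2 * (τ * (1 - t) ^ (1 / p))) := by ring
    simp only [e1, e2]
    ring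
  · have hS : MeasurableSet (Set.Ioo (0 : ℝ) 1 ×ˢ Set.Ioo (0 : ℝ) 1) :=
      measurableSet_Ioo.prod measurableSet_Ioo
    have h := hi.integrableOn (s := pPolar p '' (Set.Ioo (0 : ℝ) 1 ×ˢ Set.Ioo (0 : ℝ) 1))
    rw [integrableOn_image_iff_integrableOn_abs_det_fderiv_smul volume hS
      (fun z hz => (hasFDerivAt_pPolar hz.2).hasFDerivWithinAt) (injOn_pPolar hp)] at h
    refine h.congr_fun (fun z hz => ?_) hS
    beta_reduce
    rw [← smul_mul_assoc, abs_det_smul_ballWeight_pPolar hp hz]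

lemma Dcal_one_eq (p β : ℝ) (y : ℝ × ℝ) :
    Dcal p β 1 y = ((1 / Real.Gamma (β + 1) : ℝ) : ℂ) *
      ∫ ξ, (ballWeight p β ξ : ℂ) * e2πi (y.1 * ξ.1 + y.2 * ξ.2) := by
  rw [Dcal, ← integral_indicator (measurableSet_pnorm_rpow_lt p 1)]
  congr 2 with ξ
  by_cases h : ξ ∈ {ξ | pnorm p ξ ^ p < 1}
  · rw [Set.indicator_of_mem h, ballWeight, Set.indicator_of_mem h]
  · rw [Set.indicator_of_notMem h, ballWeight, Set.indicator_of_notMem h, Complex.ofReal_zero,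
      zero_mul]

lemma pnorm_mul {p c : ℝ} (hp : 0 < p) (hc : 0 ≤ c) (a b : ℝ) :
    pnorm p (c * a, c * b) = c * pnorm p (a, b) := by
  simp only [pnorm, abs_mul, abs_of_nonneg hc]
  rw [Real.mul_rpow hc (abs_nonneg _), Real.mul_rpow hc (abs_nonneg _), ← mul_add,
    Real.mul_rpow (by positivity) (by positivity), ← Real.rpow_mul hc, mul_one_div_cancel hp.ne',
    Real.rpow_one]

lemma abs_Jord_div_le {p ω : ℝ} (η : ℝ × ℝ) :
    |Jord p ω η| / pnorm p η ^ ω ≤ |1 / (p ^ (ω - 1) * Real.Gamma ω)| *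
      |∫ τ in (0 : ℝ)..1, Jzero p (τ * η.1, τ * η.2) * τ * (1 - τ ^ p) ^ (ω - 1)| := by
  have h : 0 ≤ pnorm p η ^ ω := by
    unfold pnorm
    positivity
  rw [Jord, div_eq_mul_one_div (pnorm p η ^ ω), mul_assoc, abs_mul, abs_of_nonneg h, ← abs_mul]
  exact div_le_of_le_mul₀ h (abs_nonneg _) (mul_comm _ _).le

/-- Absolute convergence of the series in the main theorem for `x ∈ (-1/2, 1/2]²`. -/
theorem series_abs_convergence (p β : ℝ) (hp : 0 < p) (hβ : -1 < β)
    (hint : Integrable (fun x : ℝ × ℝ => Dcal p β 1 x)) :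
    ∀ s : ℝ, 0 < s → ∀ x : ℝ × ℝ,
      x.1 ∈ Set.Ioc (-(1/2) : ℝ) (1/2) → x.2 ∈ Set.Ioc (-(1/2) : ℝ) (1/2) →
      Summable (fun n : {n : ℤ × ℤ // n ≠ 0} =>
        |Jord p (β + 1)
            (2 * Real.pi * s ^ (1 / p) * (x.1 - ((n : ℤ × ℤ).1 : ℝ)),
             2 * Real.pi * s ^ (1 / p) * (x.2 - ((n : ℤ × ℤ).2 : ℝ)))| /
          (2 * Real.pi * s ^ (1 / p) *
            pnorm p (x.1 - ((n : ℤ × ℤ).1 : ℝ), x.2 - ((n : ℤ × ℤ).2 : ℝ))) ^ (β + 1)) := by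
  intro s hs x _ _
  have hΓ : Real.Gamma (β + 1) ≠ 0 := (Real.Gamma_pos_of_pos (by linarith)).ne'
  have hF : Integrable fun y : ℝ × ℝ =>
      ∫ ξ, (ballWeight p β ξ : ℂ) * e2πi (y.1 * ξ.1 + y.2 * ξ.2) := by
    have h := hint.const_mul ((Real.Gamma (β + 1) : ℝ) : ℂ)
    refine h.congr (Filter.Eventually.of_forall fun y => ?_)
    simp only [Dcal_one_eq]
    rw [← mul_assoc, ← Complex.ofReal_mul, mul_one_div_cancel hΓ, Complex.ofReal_one, one_mul]
  have hc : 0 < s ^ (1 / p) := Real.rpow_pos_of_pos hs _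
  have hw : Integrable fun ξ => (ballWeight p β ξ : ℂ) := (integrable_ballWeight hp hβ).ofReal
  have hsum := summable_norm_fourierIntegral hw
    (fun ξ h => mem_Icc_of_ballWeight_ne_zero hp (Complex.ofReal_ne_zero.mp h)) hF hc x
  refine Summable.of_nonneg_of_le (fun n => ?_) (fun n => ?_)
    ((hsum.mul_left (|1 / (p ^ β * Real.Gamma (β + 1))| *
      ‖((1 / Real.Gamma (1 / p) ^ 2 * (1 / p) : ℝ) : ℂ)‖)).comp_injective
      (Subtype.val_injective (p := fun n : ℤ × ℤ => n ≠ 0)))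
  · unfold pnorm
    positivity
  · have h := integral_Jzero_mul hp hβ
      (s ^ (1 / p) * (x.1 - (n : ℤ × ℤ).1), s ^ (1 / p) * (x.2 - (n : ℤ × ℤ).2))
    rw [← pnorm_mul hp (by positivity)]
    simp only at h
    refine (abs_Jord_div_le _).trans (le_of_eq ?_)
    simp only [Function.comp_apply, add_sub_cancel_right]
    rw [mul_assoc |1 / (p ^ β * Real.Gamma (β + 1))|, ← norm_mul, ← h, Complex.norm_real,
      Real.norm_eq_abs]
    simp only [mul_assoc]
end

section
/- For every η = (η₁, η₂) ∈ ℝ², one has J₀^[2](η) = (1/π) · ∫₀^π cos(|η| cos θ) dθ, where |η| = (η₁² + η₂²)^(1/2) is the Euclidean norm. In particular, J₀^[2] is spherically symmetric: J₀^[2](η) depends only on |η|. -/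
open Real MeasureTheory

theorem cos_pos_of_mem_Ioo_zero_pi_div_two {θ : ℝ} (hθ : θ ∈ Set.Ioo (0 : ℝ) (π / 2)) :
    0 < Real.cos θ :=
  Real.cos_pos_of_mem_Ioo ⟨by linarith [hθ.1, Real.pi_pos], hθ.2⟩

theorem sin_pos_of_mem_Ioo_zero_pi_div_two {θ : ℝ} (hθ : θ ∈ Set.Ioo (0 : ℝ) (π / 2)) :
    0 < Real.sin θ :=
  Real.sin_pos_of_pos_of_lt_pi hθ.1 (by linarith [hθ.2, Real.pi_pos])

/-- The substitution `t = cos² θ` for functions on the open unit interval. -/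
theorem setIntegral_Ioo_zero_one_eq_cos_sq (g : ℝ → ℝ) :
    ∫ t in Set.Ioo (0 : ℝ) 1, g t =
      ∫ θ in Set.Ioo (0 : ℝ) (π / 2), 2 * (Real.cos θ * Real.sin θ) * g (Real.cos θ ^ 2) := by
  have himage : (fun θ => Real.cos θ ^ 2) '' Set.Ioo (0 : ℝ) (π / 2) = Set.Ioo 0 1 := by
    ext t
    constructor
    · rintro ⟨θ, hθ, rfl⟩
      have hc : 0 < Real.cos θ := cos_pos_of_mem_Ioo_zero_pi_div_two hθ
      have hs : 0 < Real.sin θ := sin_pos_of_mem_Ioo_zero_pi_div_two hθ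
      exact ⟨by positivity, by nlinarith [Real.sin_sq_add_cos_sq θ]⟩
    · rintro ⟨h0, h1⟩
      have hlt : √t < 1 := by rw [Real.sqrt_lt' one_pos]; simpa using h1
      refine ⟨Real.arccos √t, ⟨Real.arccos_pos.2 hlt,
        Real.arccos_lt_pi_div_two.2 (Real.sqrt_pos.2 h0)⟩, ?_⟩
      have hnonneg := Real.sqrt_nonneg t
      simp only
      rw [Real.cos_arccos (by linarith) hlt.le, Real.sq_sqrt h0.le]
  have hinj : Set.InjOn (fun θ => Real.cos θ ^ 2) (Set.Ioo (0 : ℝ) (π / 2)) := by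
    intro x hx y hy hxy
    have hcx : 0 < Real.cos x := cos_pos_of_mem_Ioo_zero_pi_div_two hx
    have hcy : 0 < Real.cos y := cos_pos_of_mem_Ioo_zero_pi_div_two hy
    exact Real.injOn_cos ⟨hx.1.le, by linarith [hx.2, Real.pi_pos]⟩
      ⟨hy.1.le, by linarith [hy.2, Real.pi_pos]⟩
      ((sq_eq_sq₀ hcx.le hcy.le).1 hxy)
  have hderiv : ∀ θ ∈ Set.Ioo (0 : ℝ) (π / 2), HasDerivWithinAt (fun θ => Real.cos θ ^ 2)
      (-(2 * (Real.cos θ * Real.sin θ))) (Set.Ioo (0 : ℝ) (π / 2)) θ := by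
    intro θ _
    refine ((Real.hasDerivAt_cos θ).pow 2).hasDerivWithinAt.congr_deriv ?_
    push_cast
    ring
  rw [← himage, integral_image_eq_integral_abs_deriv_smul measurableSet_Ioo hderiv hinj]
  refine setIntegral_congr_fun measurableSet_Ioo fun θ hθ => ?_
  have hc : 0 < Real.cos θ := cos_pos_of_mem_Ioo_zero_pi_div_two hθ
  have hs : 0 < Real.sin θ := sin_pos_of_mem_Ioo_zero_pi_div_two hθ
  have hpos : 0 < 2 * (Real.cos θ * Real.sin θ) := by positivity
  simp only [abs_neg, abs_of_pos hpos, smul_eq_mul]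

theorem Jzero_two_eq_integral_cos_mul_cos (η : ℝ × ℝ) :
    Jzero 2 η = (1 / π) * ∫ θ in (0 : ℝ)..(π / 2),
      2 * (Real.cos (η.1 * Real.cos θ) * Real.cos (η.2 * Real.sin θ)) := by
  have hpi := Real.pi_pos
  unfold Jzero
  rw [Real.Gamma_one_half_eq, Real.sq_sqrt hpi.le, div_self two_ne_zero, one_pow, mul_one,
    intervalIntegral.integral_of_le zero_le_one, intervalIntegral.integral_of_le (by positivity),
    integral_Ioc_eq_integral_Ioo, integral_Ioc_eq_integral_Ioo,
    setIntegral_Ioo_zero_one_eq_cos_sq]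
  congr 1
  refine setIntegral_congr_fun measurableSet_Ioo fun θ hθ => ?_
  have hc : 0 < Real.cos θ := cos_pos_of_mem_Ioo_zero_pi_div_two hθ
  have hs : 0 < Real.sin θ := sin_pos_of_mem_Ioo_zero_pi_div_two hθ
  have hsqrt : ∀ x : ℝ, 0 < x → (x ^ 2) ^ (1 / 2 : ℝ) = x := fun x hx => by
    rw [← Real.sqrt_eq_rpow, Real.sqrt_sq hx.le]
  have hinv : ∀ x : ℝ, 0 < x → (x ^ 2) ^ (1 / 2 - 1 : ℝ) = x⁻¹ := fun x hx => by
    rw [Real.rpow_sub (by positivity), hsqrt x hx, Real.rpow_one]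
    field_simp
  simp only [← Real.sin_sq, hsqrt _ hc, hsqrt _ hs, hinv _ hc, hinv _ hs]
  field_simp

theorem integral_cos_mul_cos_eq_integral_cos_add (a b : ℝ) :
    ∫ θ in (0 : ℝ)..(π / 2), 2 * (Real.cos (a * Real.cos θ) * Real.cos (b * Real.sin θ)) =
      ∫ θ in (-(π / 2))..(π / 2), Real.cos (a * Real.cos θ + b * Real.sin θ) := by
  set f : ℝ → ℝ := fun θ => Real.cos (a * Real.cos θ + b * Real.sin θ) with hf
  have hcont : Continuous f := by fun_prop
  have hcontneg : Continuous fun θ => f (-θ) := by fun_prop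
  have hneg : ∫ θ in (0 : ℝ)..(π / 2), f (-θ) = ∫ θ in (-(π / 2))..0, f θ := by
    rw [intervalIntegral.integral_comp_neg, neg_zero]
  rw [← intervalIntegral.integral_add_adjacent_intervals (hcont.intervalIntegrable _ 0)
    (hcont.intervalIntegrable 0 _), ← hneg, ← intervalIntegral.integral_add
    (hcontneg.intervalIntegrable _ _) (hcont.intervalIntegrable _ _)]
  refine intervalIntegral.integral_congr fun θ _ => ?_
  simp only [hf, Real.cos_neg, Real.sin_neg, mul_neg, Real.cos_add]
  ring

theorem integral_cos_add_eq_integral_cos_sqrt_mul_cos (a b : ℝ) :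
    ∫ θ in (-(π / 2))..(π / 2), Real.cos (a * Real.cos θ + b * Real.sin θ) =
      ∫ θ in (0 : ℝ)..π, Real.cos (√(a ^ 2 + b ^ 2) * Real.cos θ) := by
  set z : ℂ := ⟨a, b⟩ with hz
  have hnorm : ‖z‖ = √(a ^ 2 + b ^ 2) := by
    rw [Complex.norm_def, Complex.normSq_mk, sq, sq]
  have ha : ‖z‖ * Real.cos z.arg = a := Complex.norm_mul_cos_arg z
  have hb : ‖z‖ * Real.sin z.arg = b := Complex.norm_mul_sin_arg z
  rw [← hnorm]
  set g : ℝ → ℝ := fun θ => Real.cos (‖z‖ * Real.cos θ) with hg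
  have hper : Function.Periodic g π := fun θ => by
    simp only [hg, Real.cos_add_pi, mul_neg, Real.cos_neg]
  have hshift : ∀ θ, Real.cos (a * Real.cos θ + b * Real.sin θ) = g (θ - z.arg) := fun θ => by
    simp only [hg, Real.cos_sub]
    congr 1
    linear_combination -Real.cos θ * ha - Real.sin θ * hb
  simp only [hshift]
  rw [intervalIntegral.integral_comp_sub_right]
  convert hper.intervalIntegral_add_eq (-(π / 2) - z.arg) 0 using 2 <;> ring

/-- `J₀^[2]` coincides with the classical Bessel integral: `J₀^[2](η) = (1/π)∫₀^π cos(|η| cos θ) dθ`;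
in particular `J₀^[2]` is spherically symmetric. -/
theorem Jzero_two_eq_bessel (η : ℝ × ℝ) :
    (Jzero 2 η =
      (1 / Real.pi) *
        ∫ θ in (0:ℝ)..Real.pi, Real.cos (Real.sqrt (η.1 ^ 2 + η.2 ^ 2) * Real.cos θ)) ∧
      ∀ η' : ℝ × ℝ, Real.sqrt (η'.1 ^ 2 + η'.2 ^ 2) = Real.sqrt (η.1 ^ 2 + η.2 ^ 2) →
        Jzero 2 η' = Jzero 2 η := by
  have hbessel : ∀ ξ : ℝ × ℝ, Jzero 2 ξ =
      (1 / π) * ∫ θ in (0 : ℝ)..π, Real.cos (√(ξ.1 ^ 2 + ξ.2 ^ 2) * Real.cos θ) := fun ξ => by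
    rw [Jzero_two_eq_integral_cos_mul_cos, integral_cos_mul_cos_eq_integral_cos_add,
      integral_cos_add_eq_integral_cos_sqrt_mul_cos]
  exact ⟨hbessel η, fun η' h => by rw [hbessel η', hbessel η, h]⟩
end
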